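/- arXiv:1404.4711 — 5 statements merged into one kernel-verified Lean document; each statement's English description precedes it below -/
import Mathlib

section
/- Let m, L be positive integers with L ≤ m, let M ∈ ℂ^{m×m} be Hermitian positive semidefinite whose L largest eigenvalues μ₁ ≥ μ₂ ≥ … ≥ μ_L are all strictly positive, let V ∈ ℂ^{m×L} be a matrix whose columns are orthonormal eigenvectors of M satisfying M V = V diag(μ₁,…,μ_L), and let σ > 0, γ > 0. Define p_ℓ = (σ²/γ) μ_ℓ^{-1/2} Σ_{j=1}^L μ_j^{-1/2} for ℓ = 1,…,L, let S ∈ ℂ^{L×L} be any unitary matrix, and set U* = V diag(p₁,…,p_L)^{1/2} S^H. Then U*^H M U* is invertible, σ² tr((U*^H M U*)^{-1}) = γ, and for every Ũ ∈ ℂ^{m×L} such that Ũ^H M Ũ is invertible and σ² tr((Ũ^H M Ũ)^{-1}) ≤ γ it holds that tr(U*^H U*) ≤ tr(Ũ^H Ũ); that is, U* minimizes the transmit power among all precoders satisfying the sum-MSE constraint. -/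
open Matrix ComplexOrder

/-- If weights `d i * q i ∈ [0, 1]` sum to `L` and `d` is antitone, then `∑ √(d i) * q i` is at least
the sum of `(√(d i))⁻¹` over the `L` largest values of `d`. -/
lemma sum_inv_sqrt_le_sum_sqrt_mul {m L : ℕ} (hL : 0 < L) (hLm : L ≤ m) {d q : Fin m → ℝ}
    (hd : Antitone d) (hpos : ∀ l : Fin L, 0 < d (Fin.castLE hLm l)) (hd0 : ∀ i, 0 ≤ d i)
    (hq : ∀ i, 0 ≤ q i) (hle : ∀ i, d i * q i ≤ 1) (hsum : ∑ i, d i * q i = L) :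
    ∑ l : Fin L, (√(d (Fin.castLE hLm l)))⁻¹ ≤ ∑ i, √(d i) * q i := by
  obtain ⟨k, rfl⟩ := Nat.exists_eq_add_of_le hLm
  have hcast : ∀ l : Fin L, Fin.castLE hLm l = Fin.castAdd k l := fun _ => rfl
  simp only [hcast] at hpos ⊢
  rw [Fin.sum_univ_add] at hsum ⊢
  set last : Fin L := ⟨L - 1, by omega⟩
  set c : ℝ := (√(d (Fin.castAdd k last)))⁻¹
  have hsqrt : 0 < √(d (Fin.castAdd k last)) := Real.sqrt_pos.2 (hpos last)
  have head_bound : ∀ l : Fin L, (√(d (Fin.castAdd k l)))⁻¹ + c * (d (Fin.castAdd k l) *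
      q (Fin.castAdd k l) - 1) ≤ √(d (Fin.castAdd k l)) * q (Fin.castAdd k l) := by
    intro l
    have hl : 0 < √(d (Fin.castAdd k l)) := Real.sqrt_pos.2 (hpos l)
    have hac : (√(d (Fin.castAdd k l)))⁻¹ ≤ c := by
      refine inv_anti₀ hsqrt (Real.sqrt_le_sqrt (hd ?_))
      rw [Fin.le_def]
      simp only [Fin.val_castAdd, last]
      omega
    have heq : √(d (Fin.castAdd k l)) * q (Fin.castAdd k l) =
        (√(d (Fin.castAdd k l)))⁻¹ * (d (Fin.castAdd k l) * q (Fin.castAdd k l)) := by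
      nth_rewrite 3 [← Real.mul_self_sqrt (hd0 (Fin.castAdd k l))]
      field_simp
    rw [heq]
    nlinarith [hle (Fin.castAdd k l)]
  have tail_bound : ∀ j : Fin k, c * (d (Fin.natAdd L j) * q (Fin.natAdd L j)) ≤
      √(d (Fin.natAdd L j)) * q (Fin.natAdd L j) := by
    intro j
    have hj : √(d (Fin.natAdd L j)) ≤ √(d (Fin.castAdd k last)) := by
      refine Real.sqrt_le_sqrt (hd ?_)
      rw [Fin.le_def]
      simp only [Fin.val_castAdd, Fin.val_natAdd, last]
      omega
    have hc : c * √(d (Fin.natAdd L j)) ≤ 1 := by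
      rw [inv_mul_le_iff₀ hsqrt]
      simpa using hj
    calc c * (d (Fin.natAdd L j) * q (Fin.natAdd L j))
        = c * √(d (Fin.natAdd L j)) * (√(d (Fin.natAdd L j)) * q (Fin.natAdd L j)) := by
          nth_rewrite 1 [← Real.mul_self_sqrt (hd0 (Fin.natAdd L j))]
          ring
      _ ≤ 1 * (√(d (Fin.natAdd L j)) * q (Fin.natAdd L j)) :=
          mul_le_mul_of_nonneg_right hc (mul_nonneg (Real.sqrt_nonneg _) (hq _))
      _ = _ := one_mul _
  have hhead := Finset.sum_le_sum fun l (_ : l ∈ Finset.univ) => head_bound l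
  have htail := Finset.sum_le_sum fun j (_ : j ∈ Finset.univ) => tail_bound j
  rw [Finset.sum_add_distrib, ← Finset.mul_sum, Finset.sum_sub_distrib] at hhead
  rw [← Finset.mul_sum] at htail
  simp only [Finset.sum_const, Finset.card_univ, Fintype.card_fin, nsmul_eq_mul, mul_one] at hhead
  have hc0 : c * (∑ l : Fin L, d (Fin.castAdd k l) * q (Fin.castAdd k l) - L) +
      c * ∑ j : Fin k, d (Fin.natAdd L j) * q (Fin.natAdd L j) = 0 := by
    rw [← mul_add, sub_add_eq_add_sub, hsum, sub_self, mul_zero]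
  linarith

/-- The diagonal entries of an orthogonal projection are at most one. -/
lemma re_diag_le_one_of_mul_self {n : Type*} [Fintype n] {P : Matrix n n ℂ} (hP : P.IsHermitian)
    (hPP : P * P = P) (i : n) : (P i i).re ≤ 1 := by
  have h : (P i i).re = ∑ j, Complex.normSq (P i j) := by
    conv_lhs => rw [← hPP, Matrix.mul_apply, Complex.re_sum]
    refine Finset.sum_congr rfl fun j _ => ?_
    rw [← hP.apply j i, Complex.star_def, Complex.mul_conj, Complex.ofReal_re]
  have h' : Complex.normSq (P i i) ≤ (P i i).re := by
    rw [h]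
    exact Finset.single_le_sum (f := fun j => Complex.normSq (P i j))
      (fun j _ => Complex.normSq_nonneg _) (Finset.mem_univ i)
  rw [Complex.normSq_apply] at h'
  nlinarith [mul_self_nonneg (P i i).im]

/-- A weak-duality bound for the power of a precoder on a diagonal channel: for every multiplier `s`,
the power is at least `2 s T - s² tr((Uᴴ D U)⁻¹)`, with `T` the sum of the inverse square roots of the
`L` largest entries of `D`. -/
lemma power_lower_bound_diagonal {m L : ℕ} (hL : 0 < L) (hLm : L ≤ m) {d : Fin m → ℝ}
    (hd : Antitone d) (hpos : ∀ l : Fin L, 0 < d (Fin.castLE hLm l)) (hd0 : ∀ i, 0 ≤ d i)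
    (U : Matrix (Fin m) (Fin L) ℂ)
    (hB : IsUnit (Uᴴ * diagonal (fun i => (d i : ℂ)) * U)) {s : ℝ} (hs : 0 ≤ s) :
    2 * s * ∑ l : Fin L, (√(d (Fin.castLE hLm l)))⁻¹ -
      s ^ 2 * ((Uᴴ * diagonal (fun i => (d i : ℂ)) * U)⁻¹).trace.re ≤ (Uᴴ * U).trace.re := by
  set D : Matrix (Fin m) (Fin m) ℂ := diagonal (fun i => (d i : ℂ)) with hD
  set R : Matrix (Fin m) (Fin m) ℂ := diagonal (fun i => (√(d i) : ℂ)) with hR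
  set B := Uᴴ * D * U with hBdef
  have hRR : R * R = D := by
    rw [hR, hD, diagonal_mul_diagonal]
    congr 1
    ext i
    rw [← Complex.ofReal_mul, Real.mul_self_sqrt (hd0 i)]
  have hRH : Rᴴ = R := by
    rw [hR, diagonal_conjTranspose]
    congr 1
    ext i
    simp
  have hDpsd : D.PosSemidef :=
    PosSemidef.diagonal fun i => by simpa using hd0 i
  have hBpsd : B.PosSemidef := hDpsd.conjTranspose_mul_mul_same U
  have hBinv : B⁻¹.PosSemidef := hBpsd.inv
  have hBH : (B⁻¹)ᴴ = B⁻¹ := hBinv.isHermitian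
  have hBdet : IsUnit B.det := (isUnit_iff_isUnit_det B).1 hB
  have hmul : B⁻¹ * B = 1 := nonsing_inv_mul B hBdet
  have hmul' : B * B⁻¹ = 1 := mul_nonsing_inv B hBdet
  set Q := U * B⁻¹ * Uᴴ with hQ
  have hQpsd : Q.PosSemidef := hBinv.mul_mul_conjTranspose_same U
  have hgram : (R * U)ᴴ * (R * U) = B := by
    rw [conjTranspose_mul, hRH, hBdef, ← hRR]
    simp only [Matrix.mul_assoc]
  set P := R * Q * R with hP
  have hPeq : P = (R * U) * B⁻¹ * (R * U)ᴴ := by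
    rw [hP, hQ, conjTranspose_mul, hRH]
    simp only [Matrix.mul_assoc]
  have hPP : P * P = P := by
    calc P * P = (R * U) * B⁻¹ * ((R * U)ᴴ * (R * U)) * B⁻¹ * (R * U)ᴴ := by
          rw [hPeq]; simp only [Matrix.mul_assoc]
      _ = P := by rw [hgram, Matrix.mul_assoc _ B⁻¹ B, hmul, Matrix.mul_one, hPeq]
  have hPH : P.IsHermitian := by
    rw [hPeq]
    exact (hBinv.mul_mul_conjTranspose_same (R * U)).isHermitian
  have hPdiag : ∀ i, (P i i).re = d i * (Q i i).re := by
    intro i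
    have : P i i = ((√(d i) * √(d i) : ℝ) : ℂ) * Q i i := by
      rw [hP, hR, mul_diagonal, diagonal_mul]
      push_cast
      ring
    rw [this, Complex.re_ofReal_mul, Real.mul_self_sqrt (hd0 i)]
  have hPtr : ∑ i, d i * (Q i i).re = L := by
    have htr : P.trace = L := by
      rw [hPeq, Matrix.trace_mul_comm, ← Matrix.mul_assoc, hgram, hmul', trace_one,
        Fintype.card_fin]
    have := congrArg Complex.re htr
    simpa [Matrix.trace, hPdiag] using this
  have hT := sum_inv_sqrt_le_sum_sqrt_mul hL hLm hd hpos hd0 (q := fun i => (Q i i).re)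
    (fun i => (Complex.nonneg_iff.1 hQpsd.diag_nonneg).1)
    (fun i => by rw [← hPdiag]; exact re_diag_le_one_of_mul_self hPH hPP i) hPtr
  have hRQ : (R * Q).trace.re = ∑ i, √(d i) * (Q i i).re := by
    simp [Matrix.trace, hR, diagonal_mul]
  set Z := R * U * B⁻¹ with hZ
  have hZZ : Zᴴ * Z = B⁻¹ := by
    calc Zᴴ * Z = B⁻¹ * ((R * U)ᴴ * (R * U)) * B⁻¹ := by
          rw [hZ, conjTranspose_mul, hBH]; simp only [Matrix.mul_assoc]
      _ = B⁻¹ := by rw [hgram, hmul, Matrix.one_mul]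
  have hUZ : (Uᴴ * Z).trace = (R * Q).trace := by
    rw [Matrix.trace_mul_comm, hZ, hQ]
    simp only [Matrix.mul_assoc]
  have hZU : (Zᴴ * U).trace.re = (Uᴴ * Z).trace.re := by
    have : Zᴴ * U = (Uᴴ * Z)ᴴ := by simp
    rw [this, trace_conjTranspose]
    simp
  have hexp : (U - (s : ℂ) • Z)ᴴ * (U - (s : ℂ) • Z) =
      Uᴴ * U - (s : ℂ) • (Uᴴ * Z) - (s : ℂ) • (Zᴴ * U) + ((s ^ 2 : ℝ) : ℂ) • B⁻¹ := by
    rw [← hZZ]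
    simp only [conjTranspose_sub, conjTranspose_smul, Complex.star_def, Complex.conj_ofReal,
      Matrix.sub_mul, Matrix.mul_sub, Matrix.smul_mul, Matrix.mul_smul, smul_sub, smul_smul]
    push_cast
    rw [pow_two]
    abel
  have hnonneg : 0 ≤ ((U - (s : ℂ) • Z)ᴴ * (U - (s : ℂ) • Z)).trace.re :=
    (Complex.nonneg_iff.1 (posSemidef_conjTranspose_mul_self _).trace_nonneg).1
  rw [hexp] at hnonneg
  simp only [trace_add, trace_sub, trace_smul, smul_eq_mul, Complex.add_re, Complex.sub_re,
    Complex.re_ofReal_mul, hZU, hUZ, hRQ] at hnonneg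
  nlinarith [mul_le_mul_of_nonneg_left hT hs]

/-- Proposition 1 (optimality of the structured precoder): the precoder
`U* = V diag(p)^{1/2} Sᴴ`, built from orthonormal eigenvectors of `M`
associated to its `L` largest eigenvalues `μ₁ ≥ … ≥ μ_L > 0` and the
water-filling powers `p_ℓ = (σ²/γ) μ_ℓ^{-1/2} Σ_j μ_j^{-1/2}`, satisfies the
sum-MSE constraint `σ² tr((U*ᴴ M U*)⁻¹) = γ` with equality and minimizes the
transmit power `tr(Uᴴ U)` among all feasible precoders. -/
theorem stmt0 (m L : ℕ) (hm : 0 < m) (hL : 0 < L) (hLm : L ≤ m)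
    (M : Matrix (Fin m) (Fin m) ℂ) (hM : M.PosSemidef)
    -- full spectrum of `M`, in descending order, via a unitary eigendecomposition
    (μm : Fin m → ℝ) (hanti : Antitone μm)
    (W : Matrix (Fin m) (Fin m) ℂ) (hW : W ∈ Matrix.unitaryGroup (Fin m) ℂ)
    (hMW : M = W * Matrix.diagonal (fun i => (μm i : ℂ)) * Wᴴ)
    -- `μ` consists of the `L` largest eigenvalues, all strictly positive
    (μ : Fin L → ℝ) (hμ : ∀ ℓ : Fin L, μ ℓ = μm (Fin.castLE hLm ℓ))
    (hμpos : ∀ ℓ, 0 < μ ℓ)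
    -- `V` has orthonormal columns that are eigenvectors of `M` for `μ₁,…,μ_L`
    (V : Matrix (Fin m) (Fin L) ℂ) (hV : Vᴴ * V = 1)
    (hMV : M * V = V * Matrix.diagonal (fun ℓ => (μ ℓ : ℂ)))
    (σ γ : ℝ) (hσ : 0 < σ) (hγ : 0 < γ)
    -- water-filling powers
    (p : Fin L → ℝ)
    (hp : ∀ ℓ, p ℓ = σ ^ 2 / γ * (Real.sqrt (μ ℓ))⁻¹ * ∑ j, (Real.sqrt (μ j))⁻¹)
    (S : Matrix (Fin L) (Fin L) ℂ) (hS : S ∈ Matrix.unitaryGroup (Fin L) ℂ)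
    (Ustar : Matrix (Fin m) (Fin L) ℂ)
    (hUstar : Ustar = V * Matrix.diagonal (fun ℓ => (Real.sqrt (p ℓ) : ℂ)) * Sᴴ) :
    IsUnit (Ustarᴴ * M * Ustar) ∧
    (σ : ℂ) ^ 2 * ((Ustarᴴ * M * Ustar)⁻¹).trace = (γ : ℂ) ∧
    ∀ U : Matrix (Fin m) (Fin L) ℂ, IsUnit (Uᴴ * M * U) →
      (σ : ℂ) ^ 2 * ((Uᴴ * M * U)⁻¹).trace ≤ (γ : ℂ) →
      (Ustarᴴ * Ustar).trace ≤ (Uᴴ * U).trace := by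
  have hSS : Sᴴ * S = 1 := mem_unitaryGroup_iff'.1 hS
  have hWW : Wᴴ * W = 1 := mem_unitaryGroup_iff'.1 hW
  have hWW' : W * Wᴴ = 1 := mem_unitaryGroup_iff.1 hW
  have hsq : ∀ l, 0 < √(μ l) := fun l => Real.sqrt_pos.2 (hμpos l)
  set T := ∑ j, (√(μ j))⁻¹ with hT
  have hTpos : 0 < T :=
    Finset.sum_pos (fun l _ => inv_pos.2 (hsq l)) ⟨⟨0, hL⟩, Finset.mem_univ _⟩
  have hppos : ∀ l, 0 < p l := fun l => by
    rw [hp]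
    have := hsq l
    positivity
  have hEH : (diagonal (fun l => (√(p l) : ℂ)))ᴴ = diagonal (fun l => (√(p l) : ℂ)) := by
    rw [diagonal_conjTranspose]
    congr 1
    ext l
    simp
  have hpp : ∀ l, (√(p l) : ℂ) * √(p l) = p l := fun l => by
    rw [← Complex.ofReal_mul, Real.mul_self_sqrt (hppos l).le]
  have hpC : ∀ l, (p l : ℂ) ≠ 0 := fun l => Complex.ofReal_ne_zero.2 (hppos l).ne'
  have hμC : ∀ l, (μ l : ℂ) ≠ 0 := fun l => Complex.ofReal_ne_zero.2 (hμpos l).ne'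
  have hpower : Ustarᴴ * Ustar = S * diagonal (fun l => (p l : ℂ)) * Sᴴ := by
    calc Ustarᴴ * Ustar = S * (diagonal (fun l => (√(p l) : ℂ)) * (Vᴴ * V) *
          diagonal (fun l => (√(p l) : ℂ))) * Sᴴ := by
          rw [hUstar, conjTranspose_mul, conjTranspose_mul, hEH, conjTranspose_conjTranspose]
          simp only [Matrix.mul_assoc]
      _ = _ := by simp only [hV, Matrix.mul_one, diagonal_mul_diagonal, hpp]
  have hgain : Ustarᴴ * M * Ustar = S * diagonal (fun l => (p l : ℂ) * μ l) * Sᴴ := by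
    calc Ustarᴴ * M * Ustar = S * (diagonal (fun l => (√(p l) : ℂ)) * (Vᴴ * (M * V)) *
          diagonal (fun l => (√(p l) : ℂ))) * Sᴴ := by
          rw [hUstar, conjTranspose_mul, conjTranspose_mul, hEH, conjTranspose_conjTranspose]
          simp only [Matrix.mul_assoc]
      _ = _ := by
          have hcomm : ∀ l, (√(p l) : ℂ) * μ l * √(p l) = p l * μ l := fun l => by
            rw [mul_right_comm, hpp]
          rw [hMV, ← Matrix.mul_assoc Vᴴ, hV, Matrix.one_mul, diagonal_mul_diagonal,
            diagonal_mul_diagonal]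
          simp only [hcomm]
  have hinv : (Ustarᴴ * M * Ustar) * (S * diagonal (fun l => ((p l : ℂ) * μ l)⁻¹) * Sᴴ) = 1 := by
    calc _ = S * (diagonal (fun l => (p l : ℂ) * μ l) * (Sᴴ * S) *
          diagonal (fun l => ((p l : ℂ) * μ l)⁻¹)) * Sᴴ := by
          rw [hgain]; simp only [Matrix.mul_assoc]
      _ = S * Sᴴ := by
          have hone : ∀ l, (p l : ℂ) * μ l * ((p l : ℂ) * μ l)⁻¹ = 1 := fun l =>
            mul_inv_cancel₀ (mul_ne_zero (hpC l) (hμC l))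
          simp only [hSS, Matrix.mul_one, diagonal_mul_diagonal, hone, diagonal_one]
      _ = 1 := mem_unitaryGroup_iff.1 hS
  have htrS : ∀ f : Fin L → ℂ, (S * diagonal f * Sᴴ).trace = ∑ l, f l := fun f => by
    rw [Matrix.trace_mul_comm, ← Matrix.mul_assoc, hSS, Matrix.one_mul, trace_diagonal]
  have hpsum : ∑ l, p l = σ ^ 2 / γ * T ^ 2 := by
    simp only [hp]
    rw [← Finset.sum_mul, ← Finset.mul_sum, ← hT]
    ring
  refine ⟨IsUnit.of_mul_eq_one _ hinv, ?_, fun U hU hmse => ?_⟩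
  · rw [inv_eq_right_inv hinv, htrS]
    have hterm : ∀ l, (p l * μ l)⁻¹ = γ / σ ^ 2 / T * (√(μ l))⁻¹ := fun l => by
      have h1 := hsq l
      have h2 := Real.sq_sqrt (hμpos l).le
      rw [hp]
      generalize √(μ l) = r at h1 h2 ⊢
      rw [← h2]
      field_simp
    have hreal : σ ^ 2 * ∑ l, (p l * μ l)⁻¹ = γ := by
      simp only [hterm]
      rw [← Finset.mul_sum, ← hT]
      field_simp
    exact_mod_cast hreal
  · have hd0 : ∀ i, 0 ≤ μm i := by
      have hdiag : Wᴴ * M * W = diagonal (fun i => (μm i : ℂ)) := by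
        calc Wᴴ * M * W = (Wᴴ * W) * diagonal (fun i => (μm i : ℂ)) * (Wᴴ * W) := by
              rw [hMW]; simp only [Matrix.mul_assoc]
          _ = _ := by rw [hWW, Matrix.one_mul, Matrix.mul_one]
      have hpsd := hM.conjTranspose_mul_mul_same W
      rw [hdiag] at hpsd
      intro i
      simpa using hpsd.diag_nonneg (i := i)
    have hconj : (Wᴴ * U)ᴴ * diagonal (fun i => (μm i : ℂ)) * (Wᴴ * U) = Uᴴ * M * U := by
      rw [hMW, conjTranspose_mul, conjTranspose_conjTranspose]
      simp only [Matrix.mul_assoc]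
    have hpow : (Wᴴ * U)ᴴ * (Wᴴ * U) = Uᴴ * U := by
      calc (Wᴴ * U)ᴴ * (Wᴴ * U) = Uᴴ * (W * Wᴴ) * U := by
            rw [conjTranspose_mul, conjTranspose_conjTranspose]
            simp only [Matrix.mul_assoc]
        _ = Uᴴ * U := by rw [hWW', Matrix.mul_one]
    have hbound := power_lower_bound_diagonal hL hLm hanti (fun l => hμ l ▸ hμpos l) hd0 (Wᴴ * U)
      (by rwa [hconj]) (s := σ ^ 2 / γ * T) (by positivity)
    rw [hconj, hpow] at hbound
    simp only [← hμ, ← hT] at hbound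
    have hmse_re : σ ^ 2 * ((Uᴴ * M * U)⁻¹).trace.re ≤ γ := by
      have h := (Complex.le_def.1 hmse).1
      rwa [← Complex.ofReal_pow, Complex.re_ofReal_mul, Complex.ofReal_re] at h
    have hscaled : (σ ^ 2 / γ * T) ^ 2 * ((Uᴴ * M * U)⁻¹).trace.re ≤ σ ^ 2 / γ * T ^ 2 := by
      calc (σ ^ 2 / γ * T) ^ 2 * ((Uᴴ * M * U)⁻¹).trace.re
          = σ ^ 2 / γ ^ 2 * T ^ 2 * (σ ^ 2 * ((Uᴴ * M * U)⁻¹).trace.re) := by ring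
        _ ≤ σ ^ 2 / γ ^ 2 * T ^ 2 * γ := by gcongr
        _ = σ ^ 2 / γ * T ^ 2 := by field_simp
    have him := (Complex.nonneg_iff.1 (posSemidef_conjTranspose_mul_self U).trace_nonneg).2
    rw [hpower, htrS, ← Complex.ofReal_sum, hpsum, Complex.le_def]
    refine ⟨?_, by rw [Complex.ofReal_im, him]⟩
    rw [Complex.ofReal_re]
    linarith
end

section
/- Let m, L be positive integers with L ≤ m, let M ∈ ℂ^{m×m} be Hermitian positive semidefinite with eigenvalues μ₁ ≥ μ₂ ≥ … ≥ μ_m and μ_L > 0, and let σ > 0, γ > 0. Then for every matrix U ∈ ℂ^{m×L} such that U^H M U is invertible and σ² tr((U^H M U)^{-1}) ≤ γ, it holds that tr(U^H U) ≥ (σ²/γ) · (Σ_{ℓ=1}^L μ_ℓ^{-1/2})². -/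
open Matrix ComplexOrder

/-- A fractional selection of total weight `L` costs at least as much as selecting the first `L`
items, when the costs of the first `L` items are at most `t` and all other costs in use are at
least `t`. -/
lemma sum_castLE_le_sum_mul {m L : ℕ} (hLm : L ≤ m) (c P : Fin m → ℝ) (t : ℝ)
    (hP0 : ∀ i, 0 ≤ P i) (hP1 : ∀ i, P i ≤ 1) (hPsum : ∑ i, P i = L)
    (hlow : ∀ i : Fin m, (i : ℕ) < L → c i ≤ t)
    (hhigh : ∀ i : Fin m, L ≤ (i : ℕ) → P i = 0 ∨ t ≤ c i) :
    ∑ ℓ : Fin L, c (Fin.castLE hLm ℓ) ≤ ∑ i, P i * c i := by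
  have hsplit : ∀ f : Fin m → ℝ,
      ∑ ℓ : Fin L, f (Fin.castLE hLm ℓ) = ∑ i : Fin m, if (i : ℕ) < L then f i else 0 := by
    intro f
    rw [← Finset.sum_filter]
    refine Finset.sum_bij (fun ℓ _ => Fin.castLE hLm ℓ) ?_ ?_ ?_ ?_
    · intro ℓ _
      simp
    · intro a _ b _ h
      simpa using h
    · intro i hi
      exact ⟨⟨i, by simpa using hi⟩, Finset.mem_univ _, rfl⟩
    · intros
      rfl
  have hcount := hsplit fun _ => t
  have hterm : ∀ i : Fin m,
      (if (i : ℕ) < L then c i else 0) - (if (i : ℕ) < L then t else 0) ≤ P i * (c i - t) := by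
    intro i
    split_ifs with h
    · nlinarith [hP1 i, hlow i h]
    · rcases hhigh i (not_lt.mp h) with h0 | h0
      · simp [h0]
      · simpa using mul_nonneg (hP0 i) (sub_nonneg.mpr h0)
  have hsum := Finset.sum_le_sum fun i (_ : i ∈ Finset.univ) => hterm i
  simp only [mul_sub, Finset.sum_sub_distrib, ← Finset.sum_mul, hPsum] at hsum
  rw [← hsplit, ← hcount] at hsum
  simp only [Finset.sum_const, Finset.card_univ, Fintype.card_fin, nsmul_eq_mul] at hsum
  linarith

lemma trace_conjTranspose_mul_self_eq_sum {m n : Type*} [Fintype m] [Fintype n]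
    (X : Matrix m n ℂ) : (Xᴴ * X).trace = ((∑ j, ∑ i, ‖X i j‖ ^ 2 : ℝ) : ℂ) := by
  simp [Matrix.trace, Matrix.mul_apply, Complex.conj_mul']

/-- The Cauchy–Schwarz inequality for the Frobenius inner product. -/
lemma norm_trace_conjTranspose_mul_sq_le {m n : Type*} [Fintype m] [Fintype n]
    (X Y : Matrix m n ℂ) :
    ‖(Xᴴ * Y).trace‖ ^ 2 ≤ (Xᴴ * X).trace.re * (Yᴴ * Y).trace.re := by
  have hle : ‖(Xᴴ * Y).trace‖ ≤ ∑ p : n × m, ‖X p.2 p.1‖ * ‖Y p.2 p.1‖ := by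
    have h : (Xᴴ * Y).trace = ∑ p : n × m, star (X p.2 p.1) * Y p.2 p.1 := by
      simp [Matrix.trace, Matrix.mul_apply, Fintype.sum_prod_type]
    rw [h]
    refine (norm_sum_le _ _).trans (le_of_eq ?_)
    simp
  rw [trace_conjTranspose_mul_self_eq_sum, trace_conjTranspose_mul_self_eq_sum,
    Complex.ofReal_re, Complex.ofReal_re]
  calc ‖(Xᴴ * Y).trace‖ ^ 2 ≤ (∑ p : n × m, ‖X p.2 p.1‖ * ‖Y p.2 p.1‖) ^ 2 := by gcongr
    _ ≤ (∑ p : n × m, ‖X p.2 p.1‖ ^ 2) * ∑ p : n × m, ‖Y p.2 p.1‖ ^ 2 :=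
        Finset.sum_mul_sq_le_sq_mul_sq _ _ _
    _ = _ := by simp only [Fintype.sum_prod_type]

/-- The power–MSE trade-off for a diagonal channel Gram matrix with antitone diagonal. -/
lemma sq_sum_inv_sqrt_le_trace_mul_trace_inv {m L : ℕ} (hL : 0 < L) (hLm : L ≤ m)
    (μ : Fin m → ℝ) (hanti : Antitone μ) (hμ0 : ∀ i, 0 ≤ μ i)
    (hμL : ∀ ℓ : Fin L, 0 < μ (Fin.castLE hLm ℓ)) (V : Matrix (Fin m) (Fin L) ℂ)
    (hV : IsUnit (Vᴴ * diagonal (fun i => (μ i : ℂ)) * V)) :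
    (∑ ℓ : Fin L, (Real.sqrt (μ (Fin.castLE hLm ℓ)))⁻¹) ^ 2 ≤
      (Vᴴ * V).trace.re * ((Vᴴ * diagonal (fun i => (μ i : ℂ)) * V)⁻¹).trace.re := by
  set D : Matrix (Fin m) (Fin m) ℂ := diagonal (fun i => (μ i : ℂ)) with hD
  set R : Matrix (Fin m) (Fin m) ℂ := diagonal (fun i => (Real.sqrt (μ i) : ℂ)) with hR
  set B := Vᴴ * D * V with hB
  have hdet : IsUnit B.det := (Matrix.isUnit_iff_isUnit_det B).mp hV
  have hDH : Dᴴ = D := by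
    rw [hD, diagonal_conjTranspose]
    congr 1
    ext i
    simp
  have hRH : Rᴴ = R := by
    rw [hR, diagonal_conjTranspose]
    congr 1
    ext i
    simp
  have hRR : R * R = D := by
    rw [hR, hD, diagonal_mul_diagonal]
    congr 1
    ext i
    rw [← Complex.ofReal_mul, Real.mul_self_sqrt (hμ0 i)]
  have hBH : Bᴴ = B := by
    simp [hB, conjTranspose_mul, hDH, Matrix.mul_assoc]
  have hBiH : (B⁻¹)ᴴ = B⁻¹ := by rw [conjTranspose_nonsing_inv, hBH]
  set G := V * B⁻¹ * Vᴴ with hG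
  have hGH : Gᴴ = G := by
    simp [hG, conjTranspose_mul, hBiH, Matrix.mul_assoc]
  have hGDG : G * D * G = G := by
    calc G * D * G = V * (B⁻¹ * B) * B⁻¹ * Vᴴ := by simp only [hG, hB, Matrix.mul_assoc]
      _ = G := by rw [Matrix.nonsing_inv_mul B hdet, Matrix.mul_one]
  have hGii : ∀ i, G i i = ((∑ j, μ j * ‖G i j‖ ^ 2 : ℝ) : ℂ) := by
    intro i
    have hs : ∀ j, G j i = star (G i j) := fun j => by
      conv_lhs => rw [← hGH]
      rfl
    conv_lhs => rw [← hGDG]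
    rw [Matrix.mul_apply, Complex.ofReal_sum]
    refine Finset.sum_congr rfl fun j _ => ?_
    rw [hD, mul_diagonal, hs j, Complex.ofReal_mul, Complex.ofReal_pow, ← Complex.mul_conj']
    simp only [RCLike.star_def]
    ring
  set g : Fin m → ℝ := fun i => ∑ j, μ j * ‖G i j‖ ^ 2 with hg
  have hg0 : ∀ i, 0 ≤ g i := fun i =>
    Finset.sum_nonneg fun j _ => mul_nonneg (hμ0 j) (by positivity)
  have hgsq : ∀ i, μ i * g i ^ 2 ≤ g i := by
    intro i
    have h := Finset.single_le_sum (f := fun j => μ j * ‖G i j‖ ^ 2)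
      (fun j _ => mul_nonneg (hμ0 j) (by positivity)) (Finset.mem_univ i)
    have hn : ‖G i i‖ = g i := by
      rw [hGii i, Complex.norm_real, Real.norm_of_nonneg (hg0 i)]
    simpa only [hn] using h
  have hP1 : ∀ i, μ i * g i ≤ 1 := by
    intro i
    rcases (hg0 i).eq_or_lt with h | h
    · simp [← h]
    · exact le_of_mul_le_mul_right (by nlinarith [hgsq i]) h
  have hPsum : ∑ i, μ i * g i = L := by
    have h : (D * G).trace = (L : ℂ) := by
      calc (D * G).trace = (B * B⁻¹).trace := by
            rw [hG, ← Matrix.mul_assoc, Matrix.trace_mul_comm, hB]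
            simp only [Matrix.mul_assoc]
        _ = L := by rw [Matrix.mul_nonsing_inv B hdet, Matrix.trace_one, Fintype.card_fin]
    have h' : (D * G).trace = ((∑ i, μ i * g i : ℝ) : ℂ) := by
      simp only [Matrix.trace, Matrix.diag, hD, diagonal_mul, Complex.ofReal_sum,
        Complex.ofReal_mul, hGii, hg]
    exact_mod_cast h'.symm.trans h
  have hcross : (Vᴴ * (R * V * B⁻¹)).trace = ((∑ i, Real.sqrt (μ i) * g i : ℝ) : ℂ) := by
    have h : (Vᴴ * (R * V * B⁻¹)).trace = (R * G).trace := by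
      rw [Matrix.trace_mul_comm, hG]
      simp only [Matrix.mul_assoc]
    rw [h]
    simp only [Matrix.trace, Matrix.diag, hR, diagonal_mul, Complex.ofReal_sum,
      Complex.ofReal_mul, hGii, hg]
  have hYY : (R * V * B⁻¹)ᴴ * (R * V * B⁻¹) = B⁻¹ := by
    calc (R * V * B⁻¹)ᴴ * (R * V * B⁻¹) = B⁻¹ * (Vᴴ * (R * R) * V) * B⁻¹ := by
          simp only [conjTranspose_mul, hRH, hBiH, Matrix.mul_assoc]
      _ = B⁻¹ := by rw [hRR, ← hB, Matrix.nonsing_inv_mul B hdet, Matrix.one_mul]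
  have hCS := norm_trace_conjTranspose_mul_sq_le V (R * V * B⁻¹)
  rw [hYY, hcross, Complex.norm_real, Real.norm_eq_abs, sq_abs] at hCS
  refine le_trans ?_ hCS
  have hterm : ∀ i, Real.sqrt (μ i) * g i = μ i * g i * (Real.sqrt (μ i))⁻¹ := by
    intro i
    rcases (hμ0 i).eq_or_lt with h | h
    · simp [← h]
    · have hs := Real.sqrt_pos.mpr h
      field_simp
      rw [Real.sq_sqrt (hμ0 i), mul_comm]
  have hlast := hμL ⟨L - 1, by omega⟩
  refine pow_le_pow_left₀ (Finset.sum_nonneg fun _ _ => by positivity) ?_ 2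
  simp only [hterm]
  refine sum_castLE_le_sum_mul hLm (fun i => (Real.sqrt (μ i))⁻¹) (fun i => μ i * g i)
    (Real.sqrt (μ (Fin.castLE hLm ⟨L - 1, by omega⟩)))⁻¹
    (fun i => mul_nonneg (hμ0 i) (hg0 i)) hP1 hPsum ?_ ?_
  · intro i hi
    refine inv_anti₀ (Real.sqrt_pos.mpr hlast) (Real.sqrt_le_sqrt (hanti ?_))
    rw [Fin.le_def]
    simp only [Fin.val_castLE]
    omega
  · intro i hi
    rcases (hμ0 i).eq_or_lt with h | h
    · left
      simp [← h]
    · right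
      refine inv_anti₀ (Real.sqrt_pos.mpr h) (Real.sqrt_le_sqrt (hanti ?_))
      rw [Fin.le_def]
      simp only [Fin.val_castLE]
      omega

/-- Converse (lower-bound) part of Proposition 1: if `M` is Hermitian positive
semidefinite with eigenvalues `μ₁ ≥ … ≥ μ_m` and `μ_L > 0`, then every
precoder `U` satisfying the sum-MSE constraint `σ² tr((Uᴴ M U)⁻¹) ≤ γ` uses
power at least `(σ²/γ) (Σ_{ℓ=1}^L μ_ℓ^{-1/2})²`. -/
theorem stmt1 (m L : ℕ) (hm : 0 < m) (hL : 0 < L) (hLm : L ≤ m)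
    (M : Matrix (Fin m) (Fin m) ℂ) (hM : M.PosSemidef)
    -- eigenvalues of `M`, in descending order, via a unitary eigendecomposition
    (μ : Fin m → ℝ) (hanti : Antitone μ)
    (W : Matrix (Fin m) (Fin m) ℂ) (hW : W ∈ Matrix.unitaryGroup (Fin m) ℂ)
    (hMW : M = W * Matrix.diagonal (fun i => (μ i : ℂ)) * Wᴴ)
    -- the `L`-th largest eigenvalue (hence the first `L`) is strictly positive
    (hμL : ∀ ℓ : Fin L, 0 < μ (Fin.castLE hLm ℓ))
    (σ γ : ℝ) (hσ : 0 < σ) (hγ : 0 < γ) :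
    ∀ U : Matrix (Fin m) (Fin L) ℂ, IsUnit (Uᴴ * M * U) →
      (σ : ℂ) ^ 2 * ((Uᴴ * M * U)⁻¹).trace ≤ (γ : ℂ) →
      ((σ ^ 2 / γ * (∑ ℓ : Fin L, (Real.sqrt (μ (Fin.castLE hLm ℓ)))⁻¹) ^ 2 : ℝ) : ℂ) ≤
        (Uᴴ * U).trace := by
  intro U hU hle
  have hWW : Wᴴ * W = 1 := by
    simpa [Matrix.star_eq_conjTranspose] using Matrix.mem_unitaryGroup_iff'.mp hW
  have hWW' : W * Wᴴ = 1 := by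
    simpa [Matrix.star_eq_conjTranspose] using Matrix.mem_unitaryGroup_iff.mp hW
  have hdiag : Wᴴ * M * W = diagonal (fun i => (μ i : ℂ)) := by
    calc Wᴴ * M * W = (Wᴴ * W) * diagonal (fun i => (μ i : ℂ)) * (Wᴴ * W) := by
          rw [hMW]
          simp only [Matrix.mul_assoc]
      _ = _ := by rw [hWW, Matrix.one_mul, Matrix.mul_one]
  have hμ0 : ∀ i, 0 ≤ μ i := by
    have h := hM.conjTranspose_mul_mul_same W
    rw [hdiag, Matrix.posSemidef_diagonal_iff] at h
    exact fun i => by exact_mod_cast h i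
  have hVV : (Wᴴ * U)ᴴ * (Wᴴ * U) = Uᴴ * U := by
    calc (Wᴴ * U)ᴴ * (Wᴴ * U) = Uᴴ * (W * Wᴴ) * U := by
          simp only [conjTranspose_mul, conjTranspose_conjTranspose, Matrix.mul_assoc]
      _ = Uᴴ * U := by rw [hWW', Matrix.mul_one]
  have hVDV : (Wᴴ * U)ᴴ * diagonal (fun i => (μ i : ℂ)) * (Wᴴ * U) = Uᴴ * M * U := by
    rw [hMW]
    simp only [conjTranspose_mul, conjTranspose_conjTranspose, Matrix.mul_assoc]
  have hkey := sq_sum_inv_sqrt_le_trace_mul_trace_inv hL hLm μ hanti hμ0 hμL (Wᴴ * U)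
    (by rwa [hVDV])
  rw [hVV, hVDV] at hkey
  have hre : σ ^ 2 * ((Uᴴ * M * U)⁻¹).trace.re ≤ γ := by
    have h := (Complex.le_def.mp hle).1
    rwa [← Complex.ofReal_pow, Complex.re_ofReal_mul, Complex.ofReal_re] at h
  rw [trace_conjTranspose_mul_self_eq_sum] at hkey ⊢
  rw [Complex.ofReal_re] at hkey
  rw [Complex.real_le_real, div_mul_eq_mul_div, div_le_iff₀ hγ]
  have hpow : (0 : ℝ) ≤ ∑ j, ∑ i, ‖U i j‖ ^ 2 := by positivity
  calc _ ≤ σ ^ 2 * ((∑ j, ∑ i, ‖U i j‖ ^ 2) * ((Uᴴ * M * U)⁻¹).trace.re) := by gcongr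
    _ = (∑ j, ∑ i, ‖U i j‖ ^ 2) * (σ ^ 2 * ((Uᴴ * M * U)⁻¹).trace.re) := by ring
    _ ≤ _ := by gcongr
end

section
/- Let m, L be positive integers with L ≤ m, let M ∈ ℂ^{m×m} be Hermitian positive semidefinite whose L largest eigenvalues μ₁ ≥ … ≥ μ_L are strictly positive, let V ∈ ℂ^{m×L} have orthonormal columns that are eigenvectors of M with M V = V diag(μ₁,…,μ_L), and let σ > 0, γ > 0. Define p_ℓ = (σ²/γ) μ_ℓ^{-1/2} Σ_{j=1}^L μ_j^{-1/2}, let S ∈ ℂ^{L×L} be any unitary matrix, and set U = V diag(p₁,…,p_L)^{1/2} S^H. Then: (i) U^H M U = S diag(μ₁p₁, …, μ_L p_L) S^H; (ii) σ² tr((U^H M U)^{-1}) = γ; and (iii) tr(U^H U) = Σ_{ℓ=1}^L p_ℓ = (σ²/γ) (Σ_{ℓ=1}^L μ_ℓ^{-1/2})². -/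
open Matrix ComplexOrder

/-- The conjugate of an invertible diagonal matrix by a unitary one is inverted entrywise, so the
trace of the inverse is the sum of the inverted diagonal entries. -/
theorem Matrix.trace_inv_unitary_conj_diagonal {n : Type*} [Fintype n] [DecidableEq n]
    {S : Matrix n n ℂ} (hS : S ∈ Matrix.unitaryGroup n ℂ) {d : n → ℂ} (hd : ∀ i, d i ≠ 0) :
    ((S * Matrix.diagonal d * Sᴴ)⁻¹).trace = ∑ i, (d i)⁻¹ := by
  have hSS : Sᴴ * S = 1 := Matrix.mem_unitaryGroup_iff'.mp hS
  have hSS' : S * Sᴴ = 1 := Matrix.mem_unitaryGroup_iff.mp hS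
  have hdd : Matrix.diagonal d * Matrix.diagonal (fun i => (d i)⁻¹) = 1 := by
    rw [Matrix.diagonal_mul_diagonal, ← Matrix.diagonal_one]
    exact congrArg _ (funext fun i => mul_inv_cancel₀ (hd i))
  have hinv : (S * Matrix.diagonal d * Sᴴ)⁻¹ = S * Matrix.diagonal (fun i => (d i)⁻¹) * Sᴴ := by
    apply Matrix.inv_eq_right_inv
    calc S * Matrix.diagonal d * Sᴴ * (S * Matrix.diagonal (fun i => (d i)⁻¹) * Sᴴ)
        = S * (Matrix.diagonal d * (Sᴴ * S) * Matrix.diagonal (fun i => (d i)⁻¹)) * Sᴴ := by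
          simp only [Matrix.mul_assoc]
      _ = 1 := by rw [hSS, Matrix.mul_one, hdd, Matrix.mul_one, hSS']
  rw [hinv, Matrix.trace_mul_comm, ← Matrix.mul_assoc, hSS, Matrix.one_mul, Matrix.trace_diagonal]

/-- Achievability part of Proposition 1: the structured precoder
`U = V diag(p)^{1/2} Sᴴ` satisfies (i) `Uᴴ M U = S diag(μ₁p₁,…,μ_Lp_L) Sᴴ`,
(ii) `σ² tr((Uᴴ M U)⁻¹) = γ`, and (iii) `tr(Uᴴ U) = Σ_ℓ p_ℓ
= (σ²/γ)(Σ_ℓ μ_ℓ^{-1/2})²`. -/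
theorem stmt2 (m L : ℕ) (hm : 0 < m) (hL : 0 < L) (hLm : L ≤ m)
    (M : Matrix (Fin m) (Fin m) ℂ) (hM : M.PosSemidef)
    -- full spectrum of `M`, in descending order, via a unitary eigendecomposition
    (μm : Fin m → ℝ) (hanti : Antitone μm)
    (W : Matrix (Fin m) (Fin m) ℂ) (hW : W ∈ Matrix.unitaryGroup (Fin m) ℂ)
    (hMW : M = W * Matrix.diagonal (fun i => (μm i : ℂ)) * Wᴴ)
    -- `μ` consists of the `L` largest eigenvalues, all strictly positive
    (μ : Fin L → ℝ) (hμ : ∀ ℓ : Fin L, μ ℓ = μm (Fin.castLE hLm ℓ))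
    (hμpos : ∀ ℓ, 0 < μ ℓ)
    -- `V` has orthonormal columns that are eigenvectors of `M` for `μ₁,…,μ_L`
    (V : Matrix (Fin m) (Fin L) ℂ) (hV : Vᴴ * V = 1)
    (hMV : M * V = V * Matrix.diagonal (fun ℓ => (μ ℓ : ℂ)))
    (σ γ : ℝ) (hσ : 0 < σ) (hγ : 0 < γ)
    -- water-filling powers
    (p : Fin L → ℝ)
    (hp : ∀ ℓ, p ℓ = σ ^ 2 / γ * (Real.sqrt (μ ℓ))⁻¹ * ∑ j, (Real.sqrt (μ j))⁻¹)
    (S : Matrix (Fin L) (Fin L) ℂ) (hS : S ∈ Matrix.unitaryGroup (Fin L) ℂ)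
    (U : Matrix (Fin m) (Fin L) ℂ)
    (hU : U = V * Matrix.diagonal (fun ℓ => (Real.sqrt (p ℓ) : ℂ)) * Sᴴ) :
    Uᴴ * M * U = S * Matrix.diagonal (fun ℓ => ((μ ℓ * p ℓ : ℝ) : ℂ)) * Sᴴ ∧
    (σ : ℂ) ^ 2 * ((Uᴴ * M * U)⁻¹).trace = (γ : ℂ) ∧
    (Uᴴ * U).trace = ((∑ ℓ, p ℓ : ℝ) : ℂ) ∧
    (∑ ℓ, p ℓ : ℝ) = σ ^ 2 / γ * (∑ ℓ, (Real.sqrt (μ ℓ))⁻¹) ^ 2 := by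
  have hSS : Sᴴ * S = 1 := Matrix.mem_unitaryGroup_iff'.mp hS
  have : Nonempty (Fin L) := ⟨⟨0, hL⟩⟩
  have hsqrt : ∀ ℓ, 0 < Real.sqrt (μ ℓ) := fun ℓ => Real.sqrt_pos.mpr (hμpos ℓ)
  have hsum : 0 < ∑ j, (Real.sqrt (μ j))⁻¹ :=
    Finset.sum_pos (fun j _ => inv_pos.mpr (hsqrt j)) Finset.univ_nonempty
  have hppos : ∀ ℓ, 0 < p ℓ := fun ℓ => by
    have := hsqrt ℓ
    rw [hp]
    positivity
  have hpp : ∀ ℓ, (Real.sqrt (p ℓ) : ℂ) * Real.sqrt (p ℓ) = p ℓ := fun ℓ => by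
    rw [← Complex.ofReal_mul, Real.mul_self_sqrt (hppos ℓ).le]
  have hUH : Uᴴ = S * Matrix.diagonal (fun ℓ => (Real.sqrt (p ℓ) : ℂ)) * Vᴴ := by
    rw [hU, Matrix.conjTranspose_mul, Matrix.conjTranspose_mul, Matrix.conjTranspose_conjTranspose,
      Matrix.diagonal_conjTranspose, Matrix.mul_assoc]
    congr 3
    ext ℓ
    simp
  have hUMU : Uᴴ * M * U = S * Matrix.diagonal (fun ℓ => ((μ ℓ * p ℓ : ℝ) : ℂ)) * Sᴴ := by
    set D := Matrix.diagonal (fun ℓ => (Real.sqrt (p ℓ) : ℂ)) with hD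
    calc Uᴴ * M * U = S * (D * (Vᴴ * (M * V)) * D) * Sᴴ := by
          rw [hUH, hU]
          simp only [Matrix.mul_assoc]
      _ = S * (D * Matrix.diagonal (fun ℓ => (μ ℓ : ℂ)) * D) * Sᴴ := by
          rw [hMV, ← Matrix.mul_assoc Vᴴ, hV, Matrix.one_mul]
      _ = _ := by
          rw [hD, Matrix.diagonal_mul_diagonal, Matrix.diagonal_mul_diagonal]
          congr 3
          ext ℓ
          rw [Complex.ofReal_mul, ← hpp ℓ]
          ring
  have hinv : ∀ ℓ, (μ ℓ * p ℓ)⁻¹ =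
      γ / (σ ^ 2 * ∑ j, (Real.sqrt (μ j))⁻¹) * (Real.sqrt (μ ℓ))⁻¹ := fun ℓ => by
    have h := (hsqrt ℓ).ne'
    rw [hp]
    nth_rewrite 1 [← Real.mul_self_sqrt (hμpos ℓ).le]
    generalize ∑ j, (Real.sqrt (μ j))⁻¹ = T at hsum ⊢
    field_simp
  refine ⟨hUMU, ?_, ?_, ?_⟩
  · rw [hUMU, Matrix.trace_inv_unitary_conj_diagonal hS
      fun ℓ => Complex.ofReal_ne_zero.mpr (mul_pos (hμpos ℓ) (hppos ℓ)).ne']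
    have hreal : σ ^ 2 * ∑ ℓ, (μ ℓ * p ℓ)⁻¹ = γ := by
      simp only [hinv]
      rw [← Finset.mul_sum]
      generalize ∑ j, (Real.sqrt (μ j))⁻¹ = T at hsum ⊢
      field_simp
    exact_mod_cast congrArg Complex.ofReal hreal
  · set D := Matrix.diagonal (fun ℓ => (Real.sqrt (p ℓ) : ℂ)) with hD
    have hUU : Uᴴ * U = S * (D * D) * Sᴴ := by
      calc Uᴴ * U = S * (D * (Vᴴ * V) * D) * Sᴴ := by
            rw [hUH, hU]
            simp only [Matrix.mul_assoc]
        _ = _ := by rw [hV, Matrix.mul_one]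
    rw [hUU, Matrix.trace_mul_comm, ← Matrix.mul_assoc, hSS, Matrix.one_mul, hD,
      Matrix.diagonal_mul_diagonal, Matrix.trace_diagonal, Complex.ofReal_sum]
    exact Finset.sum_congr rfl fun ℓ _ => hpp ℓ
  · simp only [hp]
    rw [← Finset.sum_mul, ← Finset.mul_sum]
    ring
end

section
/- Let m, L be positive integers with L ≤ m, let M ∈ ℂ^{m×m} be Hermitian positive semidefinite whose L largest eigenvalues μ₁ ≥ … ≥ μ_L are strictly positive, let V ∈ ℂ^{m×L} have orthonormal columns that are eigenvectors of M with M V = V diag(μ₁,…,μ_L), and let σ > 0, γ > 0. Define p_ℓ = (σ²/γ) μ_ℓ^{-1/2} Σ_{j=1}^L μ_j^{-1/2}. Then there exists a unitary matrix S ∈ ℂ^{L×L} such that, with U = V diag(p₁,…,p_L)^{1/2} S^H, every diagonal entry of σ² (U^H M U)^{-1} equals γ/L; that is, the per-stream mean-square errors are all equalized to ε = γ/L. -/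
open Matrix ComplexOrder

/-- The normalized discrete Fourier transform matrix is unitary and all its entries have squared
modulus `1 / L`. -/
theorem exists_unitary_mul_star_eq_inv (L : ℕ) (hL : 0 < L) :
    ∃ S ∈ Matrix.unitaryGroup (Fin L) ℂ, ∀ i j, S i j * star (S i j) = (L : ℂ)⁻¹ := by
  obtain ⟨ζ, hζ⟩ : ∃ ζ : ℂ, IsPrimitiveRoot ζ L := ⟨_, Complex.isPrimitiveRoot_exp L hL.ne'⟩
  have hζ0 : ζ ≠ 0 := hζ.ne_zero hL.ne'
  have hconj : star ζ = ζ⁻¹ :=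
    (Complex.inv_eq_conj (Complex.norm_eq_one_of_pow_eq_one hζ.pow_eq_one hL.ne')).symm
  have hscale : ((√(L : ℝ) : ℝ) : ℂ)⁻¹ * ((√(L : ℝ) : ℝ) : ℂ)⁻¹ = (L : ℂ)⁻¹ := by
    rw [← mul_inv, ← Complex.ofReal_mul, Real.mul_self_sqrt L.cast_nonneg, Complex.ofReal_natCast]
  have hterm (i l k : ℕ) :
      ((√(L : ℝ) : ℝ) : ℂ)⁻¹ * ζ ^ (i * k) * star (((√(L : ℝ) : ℝ) : ℂ)⁻¹ * ζ ^ (l * k)) =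
        (L : ℂ)⁻¹ * (ζ ^ i * (ζ ^ l)⁻¹) ^ k := by
    have hreal : star ((√(L : ℝ) : ℝ) : ℂ)⁻¹ = ((√(L : ℝ) : ℝ) : ℂ)⁻¹ := by
      rw [star_inv₀]
      exact congrArg _ (Complex.conj_ofReal _)
    rw [star_mul', star_pow, hreal, hconj, ← hscale, mul_pow, ← inv_pow, ← pow_mul, ← pow_mul]
    ring
  refine ⟨Matrix.of fun i j => ((√(L : ℝ) : ℝ) : ℂ)⁻¹ * ζ ^ ((i : ℕ) * (j : ℕ)), ?_, ?_⟩
  · rw [Matrix.mem_unitaryGroup_iff]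
    ext i l
    simp only [Matrix.mul_apply, Matrix.star_apply, Matrix.of_apply, hterm, ← Finset.mul_sum]
    rw [Fin.sum_univ_eq_sum_range (fun k => (ζ ^ (i : ℕ) * (ζ ^ (l : ℕ))⁻¹) ^ k) L]
    by_cases hil : i = l
    · subst hil
      have hL0 : (L : ℂ) ≠ 0 := Nat.cast_ne_zero.mpr hL.ne'
      simp [hζ0, hL0]
    · have hne : ζ ^ (i : ℕ) * (ζ ^ (l : ℕ))⁻¹ ≠ 1 := fun h =>
        hil (Fin.ext (hζ.pow_inj i.2 l.2 ((mul_inv_eq_one₀ (pow_ne_zero _ hζ0)).mp h)))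
      have hpow : (ζ ^ (i : ℕ) * (ζ ^ (l : ℕ))⁻¹) ^ L = 1 := by
        rw [mul_pow, inv_pow, ← pow_mul, ← pow_mul, mul_comm (i : ℕ), mul_comm (l : ℕ), pow_mul,
          pow_mul, hζ.pow_eq_one]
        simp
      rw [geom_sum_eq hne, hpow, Matrix.one_apply_ne hil]
      simp
  · intro i j
    rw [Matrix.of_apply, hterm, mul_inv_cancel₀ (pow_ne_zero _ hζ0), one_pow, mul_one]

/-- Inverse of a unitarily diagonalized matrix with nonzero eigenvalues. -/
theorem inv_unitary_mul_diagonal_mul {n : Type*} [Fintype n] [DecidableEq n] {S : Matrix n n ℂ}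
    (hS : S ∈ Matrix.unitaryGroup n ℂ) {d : n → ℂ} (hd : ∀ i, d i ≠ 0) :
    (S * Matrix.diagonal d * Sᴴ)⁻¹ = S * Matrix.diagonal (fun i => (d i)⁻¹) * Sᴴ := by
  have hSS : S * Sᴴ = 1 := Matrix.mem_unitaryGroup_iff.mp hS
  have hSS' : Sᴴ * S = 1 := Matrix.mem_unitaryGroup_iff'.mp hS
  have hdd : Matrix.diagonal d * Matrix.diagonal (fun i => (d i)⁻¹) = 1 := by
    simp [Matrix.diagonal_mul_diagonal, hd]
  refine Matrix.inv_eq_right_inv ?_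
  calc S * Matrix.diagonal d * Sᴴ * (S * Matrix.diagonal (fun i => (d i)⁻¹) * Sᴴ)
      = S * (Matrix.diagonal d * (Sᴴ * S) * Matrix.diagonal (fun i => (d i)⁻¹)) * Sᴴ := by
        simp only [Matrix.mul_assoc]
    _ = 1 := by rw [hSS', Matrix.mul_one, hdd, Matrix.mul_one, hSS]

/-- MSE-equalization part of Proposition 1: there exists a unitary `S` such
that, with `U = V diag(p)^{1/2} Sᴴ`, all diagonal entries of
`σ² (Uᴴ M U)⁻¹` equal `γ/L`, i.e. the per-stream MSEs are equalized. -/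
theorem stmt3 (m L : ℕ) (hm : 0 < m) (hL : 0 < L) (hLm : L ≤ m)
    (M : Matrix (Fin m) (Fin m) ℂ) (hM : M.PosSemidef)
    -- full spectrum of `M`, in descending order, via a unitary eigendecomposition
    (μm : Fin m → ℝ) (hanti : Antitone μm)
    (W : Matrix (Fin m) (Fin m) ℂ) (hW : W ∈ Matrix.unitaryGroup (Fin m) ℂ)
    (hMW : M = W * Matrix.diagonal (fun i => (μm i : ℂ)) * Wᴴ)
    -- `μ` consists of the `L` largest eigenvalues, all strictly positive
    (μ : Fin L → ℝ) (hμ : ∀ ℓ : Fin L, μ ℓ = μm (Fin.castLE hLm ℓ))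
    (hμpos : ∀ ℓ, 0 < μ ℓ)
    -- `V` has orthonormal columns that are eigenvectors of `M` for `μ₁,…,μ_L`
    (V : Matrix (Fin m) (Fin L) ℂ) (hV : Vᴴ * V = 1)
    (hMV : M * V = V * Matrix.diagonal (fun ℓ => (μ ℓ : ℂ)))
    (σ γ : ℝ) (hσ : 0 < σ) (hγ : 0 < γ)
    -- water-filling powers
    (p : Fin L → ℝ)
    (hp : ∀ ℓ, p ℓ = σ ^ 2 / γ * (Real.sqrt (μ ℓ))⁻¹ * ∑ j, (Real.sqrt (μ j))⁻¹) :
    ∃ S ∈ Matrix.unitaryGroup (Fin L) ℂ,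
      ∀ ℓ : Fin L,
        (σ : ℂ) ^ 2 *
          ((((V * Matrix.diagonal (fun j => (Real.sqrt (p j) : ℂ)) * Sᴴ)ᴴ * M *
              (V * Matrix.diagonal (fun j => (Real.sqrt (p j) : ℂ)) * Sᴴ))⁻¹) ℓ ℓ) =
          ((γ / L : ℝ) : ℂ) := by
  obtain ⟨S, hS, hSabs⟩ := exists_unitary_mul_star_eq_inv L hL
  refine ⟨S, hS, fun ℓ => ?_⟩
  have hsqrt (j : Fin L) : 0 < √(μ j) := Real.sqrt_pos.mpr (hμpos j)
  have hT : 0 < ∑ j, (√(μ j))⁻¹ :=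
    Finset.sum_pos (fun j _ => inv_pos.mpr (hsqrt j)) ⟨⟨0, hL⟩, Finset.mem_univ _⟩
  have hppos (j : Fin L) : 0 < p j := by
    have := hsqrt j
    rw [hp]
    positivity
  have hgram : (V * Matrix.diagonal (fun j => (Real.sqrt (p j) : ℂ)) * Sᴴ)ᴴ * M *
      (V * Matrix.diagonal (fun j => (Real.sqrt (p j) : ℂ)) * Sᴴ) =
      S * Matrix.diagonal (fun j => ((p j * μ j : ℝ) : ℂ)) * Sᴴ := by
    set D := Matrix.diagonal (fun j => (Real.sqrt (p j) : ℂ)) with hD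
    have hDH : Dᴴ = D := by
      rw [hD, Matrix.diagonal_conjTranspose]
      exact congrArg _ (funext fun j => Complex.conj_ofReal _)
    calc (V * D * Sᴴ)ᴴ * M * (V * D * Sᴴ) = S * (D * (Vᴴ * (M * V)) * D) * Sᴴ := by
          simp only [Matrix.conjTranspose_mul, Matrix.conjTranspose_conjTranspose, hDH,
            Matrix.mul_assoc]
      _ = S * Matrix.diagonal (fun j => ((p j * μ j : ℝ) : ℂ)) * Sᴴ := by
          rw [hMV, ← Matrix.mul_assoc Vᴴ, hV, Matrix.one_mul, hD, Matrix.diagonal_mul_diagonal,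
            Matrix.diagonal_mul_diagonal]
          congr 3
          funext j
          rw [← Complex.ofReal_mul, ← Complex.ofReal_mul, mul_right_comm,
            Real.mul_self_sqrt (hppos j).le]
  have hinv (j : Fin L) :
      (p j * μ j)⁻¹ = γ / σ ^ 2 * (∑ j, (√(μ j))⁻¹)⁻¹ * (√(μ j))⁻¹ := by
    have hj := (hsqrt j).ne'
    have hT' := hT.ne'
    rw [hp]
    generalize ∑ j, (√(μ j))⁻¹ = T at hT'
    nth_rewrite 2 [← Real.mul_self_sqrt (hμpos j).le]
    field_simp
  have hsum : ∑ j, (p j * μ j)⁻¹ = γ / σ ^ 2 := by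
    simp only [hinv]
    rw [← Finset.mul_sum, inv_mul_cancel_right₀ hT.ne']
  have hdiag : (S * Matrix.diagonal (fun j => ((p j * μ j : ℝ) : ℂ)⁻¹) * Sᴴ) ℓ ℓ =
      (L : ℂ)⁻¹ * ((γ / σ ^ 2 : ℝ) : ℂ) := by
    rw [Matrix.mul_apply, ← hsum, Complex.ofReal_sum, Finset.mul_sum]
    refine Finset.sum_congr rfl fun j _ => ?_
    rw [Matrix.mul_diagonal, Matrix.conjTranspose_apply, mul_right_comm, hSabs, Complex.ofReal_inv]
  rw [hgram, inv_unitary_mul_diagonal_mul hS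
    (fun j => Complex.ofReal_ne_zero.mpr (mul_pos (hppos j) (hμpos j)).ne'), hdiag]
  have hσ' : (σ : ℂ) ≠ 0 := Complex.ofReal_ne_zero.mpr hσ.ne'
  push_cast
  field_simp
end

section
/- Let Q, N_R, N_T, L be positive integers, let H₁,…,H_Q ∈ ℂ^{N_R×N_T} and F₁,…,F_Q ∈ ℂ^{N_T×L} be such that H_k F_i = 0 for all k < i, and assume (H_k F_k)(H_k F_k)^H is invertible for every k. Let L ∈ ℂ^{QL×QL} be the Q×Q block matrix with [L]_{k,k} = I_L, [L]_{k,i} = (H_k F_k)^H ((H_k F_k)(H_k F_k)^H)^{-1} H_k F_i for k > i, and [L]_{k,i} = 0 for i > k. Then for every v = (v₁ᵀ,…,v_Qᵀ)ᵀ with v_i ∈ ℂ^L, writing b = (b₁ᵀ,…,b_Qᵀ)ᵀ = L^{-1} v, it holds for every k that Σ_{i=1}^Q H_k F_i b_i = H_k F_k v_k. In other words, choosing the THP feedback matrix C = L decouples the multi-user MIMO channel into Q parallel single-user links x_k = H_k F_k v_k + w_k. -/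
open Matrix

/-- Assemble a `Q × Q` array of `m × n` blocks into one big matrix. -/
def blockMat {Q m n : ℕ} (B : Fin Q → Fin Q → Matrix (Fin m) (Fin n) ℂ) :
    Matrix (Fin Q × Fin m) (Fin Q × Fin n) ℂ :=
  Matrix.of fun p q => B p.1 q.1 p.2 q.2

theorem blockMat_mulVec {Q m n : ℕ} (B : Fin Q → Fin Q → Matrix (Fin m) (Fin n) ℂ)
    (x : Fin Q × Fin n → ℂ) (k : Fin Q) :
    (fun l => (blockMat B *ᵥ x) (k, l)) = ∑ i, B k i *ᵥ (fun l => x (i, l)) := by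
  ext l
  simp [blockMat, mulVec, dotProduct, Fintype.sum_prod_type, Finset.sum_apply]

/-- A block unit-diagonal lower triangular matrix has determinant one. -/
theorem det_blockMat_of_lower_unitriangular {Q n : ℕ}
    (B : Fin Q → Fin Q → Matrix (Fin n) (Fin n) ℂ)
    (hdiag : ∀ k, B k k = 1) (hupper : ∀ k i, k < i → B k i = 0) :
    (blockMat B).det = 1 := by
  have htri : (blockMat B).BlockTriangular (fun p => OrderDual.toDual p.1) := by
    intro p q hpq
    simp [blockMat, hupper p.1 q.1 (OrderDual.toDual_lt_toDual.mp hpq)]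
  rw [htri.det_fintype]
  refine Finset.prod_eq_one fun k _ => ?_
  suffices h : (blockMat B).toSquareBlock (fun p => OrderDual.toDual p.1) k = 1 by
    rw [h, det_one]
  ext ⟨⟨i, a⟩, hi⟩ ⟨⟨j, c⟩, hj⟩
  obtain rfl : i = j := OrderDual.toDual.injective (hi.trans hj.symm)
  simp [blockMat, toSquareBlock_def, hdiag, one_apply]

/-- THP decoupling (equations (7)–(8) of the paper): with `H_k F_i = 0` for
`k < i` and the feedback matrix `C = L` equal to the block unit-diagonal lower
triangular factor of the effective channel, the precoded vector `b = L⁻¹ v`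
makes each user see only its own equivalent single-user channel:
`Σ_i H_k F_i b_i = H_k F_k v_k`. -/
theorem stmt9 (Q NR NT L : ℕ) (hQ : 0 < Q) (hNR : 0 < NR) (hNT : 0 < NT)
    (hL : 0 < L)
    (H : Fin Q → Matrix (Fin NR) (Fin NT) ℂ)
    (F : Fin Q → Matrix (Fin NT) (Fin L) ℂ)
    (hHF : ∀ k i : Fin Q, k < i → H k * F i = 0)
    (hinv : ∀ k : Fin Q, IsUnit ((H k * F k) * (H k * F k)ᴴ))
    (Lm : Fin Q → Fin Q → Matrix (Fin L) (Fin L) ℂ)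
    (hLm : ∀ k i : Fin Q, Lm k i =
      if k = i then 1
      else if i < k then
        (H k * F k)ᴴ * ((H k * F k) * (H k * F k)ᴴ)⁻¹ * (H k * F i)
      else 0)
    (v b : Fin Q × Fin L → ℂ)
    (hb : b = (blockMat Lm)⁻¹ *ᵥ v) :
    ∀ k : Fin Q,
      (∑ i : Fin Q, (H k * F i) *ᵥ (fun l => b (i, l))) =
        (H k * F k) *ᵥ (fun l => v (k, l)) := by
  intro k
  have hdet : (blockMat Lm).det = 1 :=
    det_blockMat_of_lower_unitriangular Lm (fun k => by simp [hLm])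
      (fun k i hki => by simp [hLm, hki.ne, hki.not_gt])
  have hv : blockMat Lm *ᵥ b = v := by
    rw [hb, mulVec_mulVec, mul_nonsing_inv _ (by simp [hdet]), one_mulVec]
  have hblock (i : Fin Q) : H k * F k * Lm k i = H k * F i := by
    rw [hLm]
    split_ifs with hki hik
    · rw [hki, Matrix.mul_one]
    · rw [← Matrix.mul_assoc (H k * F k) _ (H k * F i), ← Matrix.mul_assoc (H k * F k),
        mul_nonsing_inv _ ((isUnit_iff_isUnit_det _).mp (hinv k)), Matrix.one_mul]
    · rw [Matrix.mul_zero, hHF k i (lt_of_le_of_ne (not_lt.mp hik) hki)]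
  rw [← hv, blockMat_mulVec, mulVec_sum]
  simp_rw [mulVec_mulVec, hblock]
end
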